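/- Let δ>0 and let Ω_δ be a finite subgraph of δℤ². Let M = Σ_{x ∈ V(Ω_δ)} σ_x be the total magnetization of the critical Ising model on Ω_δ with plus boundary conditions. Then for every t ≥ 0, log E⁺[exp(tM)] ≤ t E⁺[M] + (t²/2) E⁺[(M − E⁺[M])²]. -/

import Mathlib

open scoped Classical

noncomputable section

/-- Vertices of the square lattice (the lattice `δℤ²` is represented by integer
coordinates, the point `p` standing for `δ·p`). -/
abbrev V2 := ℤ × ℤ

/-- The four nearest neighbours of a lattice point. -/
def nbrs (p : V2) : Finset V2 :=
  {(p.1 + 1, p.2), (p.1 - 1, p.2), (p.1, p.2 + 1), (p.1, p.2 - 1)}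

/-- The boundary `∂Ω` of a finite vertex set `V`. -/
def bdry (V : Finset V2) : Finset V2 := V.biUnion nbrs \ V

/-- `V ∪ ∂V`. -/
def fullSet (V : Finset V2) : Finset V2 := V ∪ bdry V

/-- Nearest-neighbour edges with at least one endpoint in `V`. -/
def edgesV (V : Finset V2) : Finset (Sym2 V2) :=
  V.biUnion fun v => (nbrs v).image fun w => s(v, w)

/-- `σ_x σ_y` for an (unordered) edge `{x,y}`. -/
def pairProd (σ : V2 → ℝ) : Sym2 V2 → ℝ :=
  Sym2.lift ⟨fun a b => σ a * σ b, fun a b => mul_comm _ _⟩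

/-- The critical inverse temperature `β_c = (1/2) log(√2+1)`. -/
def betaC : ℝ := Real.log (Real.sqrt 2 + 1) / 2

/-- The spin configuration (with values `±1`) determined by a boolean labelling of
`V ∪ ∂V`; the (irrelevant) spins outside of `V ∪ ∂V` are set to `+1`. -/
def spin (V : Finset V2) (g : ↥(fullSet V) → Bool) : V2 → ℝ :=
  fun x => if h : x ∈ fullSet V then (if g ⟨x, h⟩ then 1 else -1) else 1

/-- Ising weight with plus boundary conditions at inverse temperature `β`. -/
def wPlus (β : ℝ) (V : Finset V2) (σ : V2 → ℝ) : ℝ :=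
  Real.exp (β * ∑ e ∈ edgesV V, pairProd σ e) *
    (if ∀ w ∈ bdry V, σ w = 1 then 1 else 0)

/-- Expectation for the Ising model on `V` with plus boundary conditions. -/
def ePlus (β : ℝ) (V : Finset V2) (f : (V2 → ℝ) → ℝ) : ℝ :=
  (∑ g : ↥(fullSet V) → Bool, wPlus β V (spin V g) * f (spin V g)) /
    (∑ g : ↥(fullSet V) → Bool, wPlus β V (spin V g))

/-- The total magnetization `M = Σ_{x ∈ V} σ_x`. -/
def mag (V : Finset V2) (σ : V2 → ℝ) : ℝ := ∑ x ∈ V, σ x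

/-! ### Four replicas of a single spin -/

/-- The `±1` value of a boolean spin. -/
def spinVal (b : Bool) : ℝ := if b then 1 else -1

/-- Four replicas of a spin. -/
abbrev Quad := Bool × Bool × Bool × Bool

/-- The sum of the four replicas. -/
def quadSum (x : Quad) : ℝ :=
  spinVal x.1 + spinVal x.2.1 + spinVal x.2.2.1 + spinVal x.2.2.2

/-- The first of the three differences in the Ellis–Monroe rotation. -/
def quadDiff₁ (x : Quad) : ℝ :=
  spinVal x.1 + spinVal x.2.1 - spinVal x.2.2.1 - spinVal x.2.2.2

/-- The second of the three differences in the Ellis–Monroe rotation. -/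
def quadDiff₂ (x : Quad) : ℝ :=
  spinVal x.1 - spinVal x.2.1 + spinVal x.2.2.1 - spinVal x.2.2.2

/-- The third of the three differences in the Ellis–Monroe rotation. -/
def quadDiff₃ (x : Quad) : ℝ :=
  -spinVal x.1 + spinVal x.2.1 + spinVal x.2.2.1 - spinVal x.2.2.2

/-- Monomials in the rotated replica variables. -/
def quadMonomial (n : ℕ × ℕ × ℕ × ℕ) (x : Quad) : ℝ :=
  quadSum x ^ n.1 * quadDiff₁ x ^ n.2.1 * quadDiff₂ x ^ n.2.2.1 * quadDiff₃ x ^ n.2.2.2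

lemma quadMonomial_add (m n : ℕ × ℕ × ℕ × ℕ) (x : Quad) :
    quadMonomial (m + n) x = quadMonomial m x * quadMonomial n x := by
  simp only [quadMonomial, Prod.fst_add, Prod.snd_add, pow_add]
  ring

lemma sum_quadMonomial_nonneg (n : ℕ × ℕ × ℕ × ℕ) : 0 ≤ ∑ x, quadMonomial n x := by
  obtain ⟨a, b, c, d⟩ := n
  simp only [quadMonomial, Fintype.sum_prod_type, Fintype.sum_bool, quadSum, quadDiff₁,
    quadDiff₂, quadDiff₃, spinVal]
  norm_num
  have h0 : ∀ n : ℕ, (0 : ℝ) ≤ 0 ^ n := fun n => pow_nonneg le_rfl n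
  have ha := h0 a
  have hb := h0 b
  have hc := h0 c
  have hd := h0 d
  generalize (0 : ℝ) ^ a = a0 at *
  generalize (0 : ℝ) ^ b = b0 at *
  generalize (0 : ℝ) ^ c = c0 at *
  generalize (0 : ℝ) ^ d = d0 at *
  rcases Nat.even_or_odd a with ea | ea <;> rcases Nat.even_or_odd b with eb | eb <;>
  rcases Nat.even_or_odd c with ec | ec <;> rcases Nat.even_or_odd d with ed | ed <;>
  simp only [ea.neg_pow, eb.neg_pow, ec.neg_pow, ed.neg_pow] <;> ring_nf <;> positivity

lemma quadMonomial_true_nonneg (n : ℕ × ℕ × ℕ × ℕ) :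
    0 ≤ quadMonomial n (true, true, true, true) := by
  simp only [quadMonomial, quadSum, quadDiff₁, quadDiff₂, quadDiff₃, spinVal]
  norm_num
  positivity

/-! ### The cone generated by the rotated variables -/

section Cone

variable {ι : Type*} [Fintype ι]

/-- Products over the sites of monomials in the rotated variables, with nonnegative coefficient. -/
def monomialSubmonoid (ι : Type*) [Fintype ι] : Submonoid ((ι → Quad) → ℝ) where
  carrier := {f | ∃ (r : ℝ) (n : ι → ℕ × ℕ × ℕ × ℕ), 0 ≤ r ∧
    f = fun ω => r * ∏ i, quadMonomial (n i) (ω i)}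
  one_mem' := ⟨1, 0, zero_le_one, by ext ω; simp [quadMonomial]⟩
  mul_mem' := by
    rintro _ _ ⟨r, m, hr, rfl⟩ ⟨s, n, hs, rfl⟩
    refine ⟨r * s, m + n, mul_nonneg hr hs, ?_⟩
    ext ω
    simp only [Pi.mul_apply, Pi.add_apply, quadMonomial_add, Finset.prod_mul_distrib]
    ring

/-- Polynomials with nonnegative coefficients in the rotated variables. -/
def positiveCone (ι : Type*) [Fintype ι] : Subsemiring ((ι → Quad) → ℝ) :=
  (monomialSubmonoid ι).subsemiringClosure

lemma monomial_mem_positiveCone (n : ι → ℕ × ℕ × ℕ × ℕ) :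
    (fun ω => ∏ i, quadMonomial (n i) (ω i)) ∈ positiveCone ι :=
  (Submonoid.subsemiringClosure_mem _).2
    (AddSubmonoid.subset_closure ⟨1, n, zero_le_one, by simp⟩)

lemma const_mem_positiveCone {r : ℝ} (hr : 0 ≤ r) : (fun _ => r) ∈ positiveCone ι :=
  (Submonoid.subsemiringClosure_mem _).2
    (AddSubmonoid.subset_closure ⟨r, 0, hr, by simp [quadMonomial]⟩)

lemma const_mul_mem_positiveCone {r : ℝ} (hr : 0 ≤ r) {f : (ι → Quad) → ℝ}
    (hf : f ∈ positiveCone ι) : (fun ω => r * f ω) ∈ positiveCone ι :=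
  mul_mem (const_mem_positiveCone hr) hf

lemma sum_mem_positiveCone {κ : Type*} {s : Finset κ} {f : κ → (ι → Quad) → ℝ}
    (hf : ∀ k ∈ s, f k ∈ positiveCone ι) : (fun ω => ∑ k ∈ s, f k ω) ∈ positiveCone ι := by
  have h := sum_mem hf
  convert h using 1
  ext ω
  simp

lemma quadMonomial_apply_mem_positiveCone [DecidableEq ι] (n : ℕ × ℕ × ℕ × ℕ) (i : ι) :
    (fun ω => quadMonomial n (ω i)) ∈ positiveCone ι := by
  convert monomial_mem_positiveCone (Pi.single i n) using 2 with ω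
  rw [Finset.prod_eq_single i]
  · simp
  · intro j _ hj
    simp [Pi.single_eq_of_ne hj, quadMonomial]
  · simp

lemma quadSum_mem_positiveCone (i : ι) : (fun ω => quadSum (ω i)) ∈ positiveCone ι := by
  simpa [quadMonomial] using quadMonomial_apply_mem_positiveCone (1, 0, 0, 0) i

lemma quadDiff₁_mem_positiveCone (i : ι) : (fun ω => quadDiff₁ (ω i)) ∈ positiveCone ι := by
  simpa [quadMonomial] using quadMonomial_apply_mem_positiveCone (0, 1, 0, 0) i

lemma quadDiff₂_mem_positiveCone (i : ι) : (fun ω => quadDiff₂ (ω i)) ∈ positiveCone ι := by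
  simpa [quadMonomial] using quadMonomial_apply_mem_positiveCone (0, 0, 1, 0) i

lemma quadDiff₃_mem_positiveCone (i : ι) : (fun ω => quadDiff₃ (ω i)) ∈ positiveCone ι := by
  simpa [quadMonomial] using quadMonomial_apply_mem_positiveCone (0, 0, 0, 1) i

/-- The replicated pair interaction is invariant under the rotation. -/
lemma pair_mem_positiveCone (i j : ι) :
    (fun ω : ι → Quad => spinVal (ω i).1 * spinVal (ω j).1 +
      spinVal (ω i).2.1 * spinVal (ω j).2.1 + spinVal (ω i).2.2.1 * spinVal (ω j).2.2.1 +
      spinVal (ω i).2.2.2 * spinVal (ω j).2.2.2) ∈ positiveCone ι := by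
  have h := const_mul_mem_positiveCone (ι := ι) (r := 1 / 4) (by norm_num)
    (add_mem (add_mem (add_mem
      (mul_mem (quadSum_mem_positiveCone i) (quadSum_mem_positiveCone j))
      (mul_mem (quadDiff₁_mem_positiveCone i) (quadDiff₁_mem_positiveCone j)))
      (mul_mem (quadDiff₂_mem_positiveCone i) (quadDiff₂_mem_positiveCone j)))
      (mul_mem (quadDiff₃_mem_positiveCone i) (quadDiff₃_mem_positiveCone j)))
  convert h using 2 with ω
  simp only [Pi.add_apply, Pi.mul_apply, quadSum, quadDiff₁, quadDiff₂, quadDiff₃]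
  ring

variable [DecidableEq ι] {ρ : ι → Quad → ℝ}

lemma sum_prod_mul_nonneg (hρ : ∀ i n, 0 ≤ ∑ x, ρ i x * quadMonomial n x)
    {f : (ι → Quad) → ℝ} (hf : f ∈ positiveCone ι) :
    0 ≤ ∑ ω : ι → Quad, (∏ i, ρ i (ω i)) * f ω := by
  rw [positiveCone, Submonoid.subsemiringClosure_mem] at hf
  induction hf using AddSubmonoid.closure_induction with
  | mem f hf =>
    obtain ⟨r, n, hr, rfl⟩ := hf
    have h : ∑ ω : ι → Quad, (∏ i, ρ i (ω i)) * (r * ∏ i, quadMonomial (n i) (ω i)) =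
        r * ∏ i, ∑ x, ρ i x * quadMonomial (n i) x := by
      rw [Fintype.prod_sum, Finset.mul_sum]
      refine Finset.sum_congr rfl fun ω _ => ?_
      rw [Finset.prod_mul_distrib]
      ring
    rw [h]
    exact mul_nonneg hr (Finset.prod_nonneg fun i _ => hρ i _)
  | zero => simp
  | add f g _ _ hf hg =>
    simp only [Pi.add_apply, mul_add, Finset.sum_add_distrib]
    exact add_nonneg hf hg

lemma sum_prod_mul_exp_mul_nonneg (hρ : ∀ i n, 0 ≤ ∑ x, ρ i x * quadMonomial n x)
    {H f : (ι → Quad) → ℝ} (hH : H ∈ positiveCone ι) (hf : f ∈ positiveCone ι) :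
    0 ≤ ∑ ω : ι → Quad, (∏ i, ρ i (ω i)) * (Real.exp (H ω) * f ω) := by
  have hlim : Filter.Tendsto (fun N => ∑ ω : ι → Quad, (∏ i, ρ i (ω i)) *
      ((∑ k ∈ Finset.range N, H ω ^ k / k.factorial) * f ω)) Filter.atTop
      (nhds (∑ ω : ι → Quad, (∏ i, ρ i (ω i)) * (Real.exp (H ω) * f ω))) := by
    refine tendsto_finsetSum _ fun ω _ => Filter.Tendsto.const_mul _ (Filter.Tendsto.mul_const _ ?_)
    rw [Real.exp_eq_exp_ℝ]
    exact (NormedSpace.expSeries_div_hasSum_exp (H ω)).tendsto_sum_nat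
  refine ge_of_tendsto' hlim fun N => ?_
  refine sum_prod_mul_nonneg hρ (f := fun ω => (∑ k ∈ Finset.range N,
    H ω ^ k / k.factorial) * f ω) (mul_mem (sum_mem_positiveCone fun k _ => ?_) hf)
  convert const_mul_mem_positiveCone (r := (k.factorial : ℝ)⁻¹) (by positivity)
    (pow_mem hH k) using 2 with ω
  simp only [Pi.pow_apply]
  ring

end Cone

/-! ### Cumulants of a finite weighted sum -/

section Cumulants

variable {G : Type*} [Fintype G]

/-- The unnormalized `k`-th moment of `m` under the weight `w`, tilted by `exp (s * m)`. -/
def tiltedMoment (w m : G → ℝ) (k : ℕ) (s : ℝ) : ℝ :=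
  ∑ g, w g * Real.exp (s * m g) * m g ^ k

lemma hasDerivAt_tiltedMoment (w m : G → ℝ) (k : ℕ) (s : ℝ) :
    HasDerivAt (tiltedMoment w m k) (tiltedMoment w m (k + 1) s) s := by
  unfold tiltedMoment
  refine HasDerivAt.fun_sum fun g _ => ?_
  have h := ((((hasDerivAt_id s).mul_const (m g)).exp).const_mul (w g)).mul_const (m g ^ k)
  refine h.congr_deriv ?_
  simp only [id]
  ring

lemma sum_four_replicas (w m : G → ℝ) :
    ∑ a, ∑ b, ∑ c, ∑ d, w a * w b * w c * w d *
      ((m a + m b - m c - m d) * (m a - m b + m c - m d) * (-m a + m b + m c - m d)) =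
    -4 * ((∑ g, w g * m g ^ 3) * (∑ g, w g) ^ 3
      - 3 * (∑ g, w g * m g) * (∑ g, w g * m g ^ 2) * (∑ g, w g) ^ 2
      + 2 * (∑ g, w g * m g) ^ 3 * ∑ g, w g) := by
  set z0 := ∑ g, w g with h0
  set z1 := ∑ g, w g * m g with h1
  set z2 := ∑ g, w g * m g ^ 2 with h2
  set z3 := ∑ g, w g * m g ^ 3 with h3
  have key : ∀ p0 p1 p2 p3 : ℝ, ∑ g, w g * (p0 + p1 * m g + p2 * m g ^ 2 + p3 * m g ^ 3) =
      p0 * z0 + p1 * z1 + p2 * z2 + p3 * z3 := by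
    intro p0 p1 p2 p3
    rw [h0, h1, h2, h3]
    simp only [Finset.mul_sum, ← Finset.sum_add_distrib]
    exact Finset.sum_congr rfl fun g _ => by ring
  have cubic : ∀ (F : G → ℝ) (c p0 p1 p2 p3 : ℝ),
      (∀ g, F g = c * (w g * (p0 + p1 * m g + p2 * m g ^ 2 + p3 * m g ^ 3))) →
      ∑ g, F g = c * (p0 * z0 + p1 * z1 + p2 * z2 + p3 * z3) := by
    intro F c p0 p1 p2 p3 h
    rw [Finset.sum_congr rfl fun g _ => h g, ← Finset.mul_sum, key]
  have hd : ∀ a b c, ∑ d, w a * w b * w c * w d *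
      ((m a + m b - m c - m d) * (m a - m b + m c - m d) * (-m a + m b + m c - m d)) =
      (w a * w b * w c) *
      (((m a + m b - m c) * (m a - m b + m c) * (-m a + m b + m c)) * z0
        + (m a ^ 2 + m b ^ 2 + m c ^ 2 - 2 * m a * m b - 2 * m a * m c - 2 * m b * m c) * z1
        + (m a + m b + m c) * z2 + (-1) * z3) := fun a b c =>
    cubic _ _ _ _ _ _ fun d => by ring
  have hc : ∀ a b, ∑ c, (w a * w b * w c) *
      (((m a + m b - m c) * (m a - m b + m c) * (-m a + m b + m c)) * z0
        + (m a ^ 2 + m b ^ 2 + m c ^ 2 - 2 * m a * m b - 2 * m a * m c - 2 * m b * m c) * z1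
        + (m a + m b + m c) * z2 + (-1) * z3) =
      (w a * w b) *
      ((-(m a + m b) * (m a - m b) ^ 2 * z0 + (m a - m b) ^ 2 * z1 + (m a + m b) * z2 - z3) * z0
        + ((m a - m b) ^ 2 * z0 - 2 * (m a + m b) * z1 + z2) * z1
        + ((m a + m b) * z0 + z1) * z2 + (-z0) * z3) := fun a b =>
    cubic _ _ _ _ _ _ fun c => by ring
  have hb : ∀ a, ∑ b, (w a * w b) *
      ((-(m a + m b) * (m a - m b) ^ 2 * z0 + (m a - m b) ^ 2 * z1 + (m a + m b) * z2 - z3) * z0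
        + ((m a - m b) ^ 2 * z0 - 2 * (m a + m b) * z1 + z2) * z1
        + ((m a + m b) * z0 + z1) * z2 + (-z0) * z3) =
      w a *
      (((-m a ^ 3 * z0 + m a ^ 2 * z1 + m a * z2 - z3) * z0
          + (m a ^ 2 * z0 - 2 * m a * z1 + z2) * z1 + (m a * z0 + z1) * z2 - z0 * z3) * z0
        + ((m a ^ 2 * z0 - 2 * m a * z1 + z2) * z0
          + (-2 * m a * z0 - 2 * z1) * z1 + z0 * z2) * z1
        + ((m a * z0 + z1) * z0 + z0 * z1) * z2 + (-z0 ^ 2) * z3) := fun a =>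
    cubic _ _ _ _ _ _ fun b => by ring
  simp only [hd, hc, hb]
  rw [cubic _ 1
    (-z3 * z0 ^ 2 + z2 * z1 * z0 + z1 * z2 * z0 - z0 ^ 2 * z3
      + z2 * z0 * z1 - 2 * z1 ^ 3 + z0 * z2 * z1 + 2 * z1 * z0 * z2 - z0 ^ 2 * z3)
    (3 * z2 * z0 ^ 2 - 6 * z1 ^ 2 * z0) (3 * z1 * z0 ^ 2) (-z0 ^ 3) fun a => by ring]
  ring

/-- If the third cumulant is nonpositive along the tilts `s ≥ 0`, then the logarithmic moment
generating function is bounded by its second order Taylor polynomial. -/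
lemma log_tiltedMoment_le {w m : G → ℝ} (hw : ∀ g, 0 ≤ w g) (hpos : 0 < ∑ g, w g)
    (hκ : ∀ s, 0 ≤ s → tiltedMoment w m 3 s * tiltedMoment w m 0 s ^ 3
      - 3 * tiltedMoment w m 1 s * tiltedMoment w m 2 s * tiltedMoment w m 0 s ^ 2
      + 2 * tiltedMoment w m 1 s ^ 3 * tiltedMoment w m 0 s ≤ 0) {t : ℝ} (ht : 0 ≤ t) :
    Real.log (tiltedMoment w m 0 t) ≤ Real.log (tiltedMoment w m 0 0)
      + t * (tiltedMoment w m 1 0 / tiltedMoment w m 0 0)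
      + t ^ 2 / 2 * (tiltedMoment w m 2 0 / tiltedMoment w m 0 0
        - (tiltedMoment w m 1 0 / tiltedMoment w m 0 0) ^ 2) := by
  set Z := tiltedMoment w m
  have hZ : ∀ s, 0 < Z 0 s := by
    intro s
    obtain ⟨g, _, hg⟩ := Finset.exists_lt_of_sum_lt (f := fun _ => (0 : ℝ)) (by simpa using hpos)
    refine Finset.sum_pos' (fun g _ => ?_) ⟨g, Finset.mem_univ g, ?_⟩
    · have := hw g
      positivity
    · positivity
  have hd : ∀ k s, HasDerivAt (Z k) (Z (k + 1) s) s := hasDerivAt_tiltedMoment w m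
  have antitone_of : ∀ f f' : ℝ → ℝ, (∀ s, HasDerivAt f (f' s) s) → (∀ s, 0 ≤ s → f' s ≤ 0) →
      ∀ s, 0 ≤ s → f s ≤ f 0 := by
    intro f f' hf hf' s hs
    refine antitoneOn_of_deriv_nonpos (convex_Ici (0 : ℝ))
      (fun x _ => (hf x).continuousAt.continuousWithinAt)
      (fun x _ => (hf x).differentiableAt.differentiableWithinAt) (fun x hx => ?_)
      (Set.self_mem_Ici) hs hs
    rw [(hf x).deriv]
    rw [interior_Ici] at hx
    exact hf' x (le_of_lt hx)
  have hmean : ∀ s, HasDerivAt (fun s => Z 1 s / Z 0 s) (Z 2 s / Z 0 s - (Z 1 s / Z 0 s) ^ 2) s := by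
    intro s
    refine ((hd 1 s).div (hd 0 s) (hZ s).ne').congr_deriv ?_
    have := (hZ s).ne'
    field_simp
  have hvar : ∀ s, HasDerivAt (fun s => Z 2 s / Z 0 s - (Z 1 s / Z 0 s) ^ 2)
      ((Z 3 s * Z 0 s ^ 3 - 3 * Z 1 s * Z 2 s * Z 0 s ^ 2 + 2 * Z 1 s ^ 3 * Z 0 s) / Z 0 s ^ 4) s := by
    intro s
    refine (((hd 2 s).div (hd 0 s) (hZ s).ne').sub ((hmean s).pow 2)).congr_deriv ?_
    have := (hZ s).ne'
    simp only [Nat.cast_ofNat, Nat.add_one_sub_one, pow_one]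
    field_simp
    ring
  have var_le := antitone_of _ _ hvar fun s hs =>
    div_nonpos_of_nonpos_of_nonneg (hκ s hs) (pow_nonneg (hZ s).le 4)
  set μ := Z 1 0 / Z 0 0
  set v := Z 2 0 / Z 0 0 - μ ^ 2
  have mean_le := antitone_of (fun s => Z 1 s / Z 0 s - v * s) _
    (fun s => (hmean s).sub ((hasDerivAt_id s).const_mul v)) fun s hs => by
      have := var_le s hs
      linarith
  have log_le := antitone_of (fun s => Real.log (Z 0 s) - (μ * s + v / 2 * s ^ 2)) _
    (fun s => ((hd 0 s).log (hZ s).ne').sub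
      (((hasDerivAt_id s).const_mul μ).add ((hasDerivAt_pow 2 s).const_mul (v / 2))))
    fun s hs => by
      have := mean_le s hs
      norm_num
      simp only [mul_zero, sub_zero] at this
      linarith
  have := log_le t ht
  norm_num at this
  linarith

end Cumulants

/-! ### The Ising model with plus boundary conditions -/

/-- The four replicas of a configuration. -/
def replicaEquiv (ι : Type*) : (ι → Quad) ≃ (ι → Bool) × (ι → Bool) × (ι → Bool) × (ι → Bool) where
  toFun ω := (fun i => (ω i).1, fun i => (ω i).2.1, fun i => (ω i).2.2.1, fun i => (ω i).2.2.2)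
  invFun g i := (g.1 i, g.2.1 i, g.2.2.1 i, g.2.2.2 i)
  left_inv _ := rfl
  right_inv _ := rfl

lemma spin_of_mem {V : Finset V2} (g : ↥(fullSet V) → Bool) {x : V2} (hx : x ∈ fullSet V) :
    spin V g x = spinVal (g ⟨x, hx⟩) := by
  simp [spin, spinVal, hx]

lemma mem_fullSet_of_mem {V : Finset V2} {x : V2} (hx : x ∈ V) : x ∈ fullSet V :=
  Finset.mem_union_left _ hx

/-- The a priori weight of a replicated spin: free inside `V`, frozen to plus on the boundary. -/
def quadWeight (V : Finset V2) (i : ↥(fullSet V)) (x : Quad) : ℝ :=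
  if i.1 ∈ V ∨ x = (true, true, true, true) then 1 else 0

lemma sum_quadWeight_mul_quadMonomial_nonneg (V : Finset V2) (i : ↥(fullSet V))
    (n : ℕ × ℕ × ℕ × ℕ) : 0 ≤ ∑ x, quadWeight V i x * quadMonomial n x := by
  by_cases hi : i.1 ∈ V
  · simpa [quadWeight, hi] using sum_quadMonomial_nonneg n
  · simpa [quadWeight, hi] using quadMonomial_true_nonneg n

lemma boundary_plus_iff (V : Finset V2) (g : ↥(fullSet V) → Bool) :
    (∀ w ∈ bdry V, spin V g w = 1) ↔ ∀ i : ↥(fullSet V), i.1 ∈ V ∨ g i = true := by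
  have hval : ∀ b, spinVal b = 1 ↔ b = true := by
    intro b
    cases b <;> norm_num [spinVal]
  constructor
  · rintro h ⟨x, hx⟩
    rcases Finset.mem_union.1 hx with hV | hB
    · exact Or.inl hV
    · exact Or.inr ((hval _).1 (spin_of_mem g hx ▸ h x hB))
  · intro h w hw
    have hx : w ∈ fullSet V := Finset.mem_union_right _ hw
    rw [spin_of_mem g hx, hval]
    exact (h ⟨w, hx⟩).resolve_left (Finset.mem_sdiff.1 hw).2

lemma prod_quadWeight (V : Finset V2) (ω : ↥(fullSet V) → Quad) :
    ∏ i, quadWeight V i (ω i) =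
      (if ∀ w ∈ bdry V, spin V (fun i => (ω i).1) w = 1 then 1 else 0) *
      (if ∀ w ∈ bdry V, spin V (fun i => (ω i).2.1) w = 1 then 1 else 0) *
      (if ∀ w ∈ bdry V, spin V (fun i => (ω i).2.2.1) w = 1 then 1 else 0) *
      (if ∀ w ∈ bdry V, spin V (fun i => (ω i).2.2.2) w = 1 then 1 else 0) := by
  simp only [boundary_plus_iff, quadWeight, Prod.ext_iff]
  rw [Finset.prod_ite_zero]
  simp only [ite_zero_mul_ite_zero, Finset.prod_const_one, mul_one, Finset.mem_univ, true_imp_iff]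
  refine if_congr ?_ rfl rfl
  simp only [← forall_and]
  exact forall_congr' fun i => by tauto

lemma replica_edge_mem_positiveCone {V : Finset V2} {e : Sym2 V2} (he : e ∈ edgesV V) :
    (fun ω : ↥(fullSet V) → Quad => pairProd (spin V fun i => (ω i).1) e +
      pairProd (spin V fun i => (ω i).2.1) e + pairProd (spin V fun i => (ω i).2.2.1) e +
      pairProd (spin V fun i => (ω i).2.2.2) e) ∈ positiveCone ↥(fullSet V) := by
  simp only [edgesV, Finset.mem_biUnion, Finset.mem_image] at he
  obtain ⟨v, hv, w, hw, rfl⟩ := he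
  have hv' : v ∈ fullSet V := mem_fullSet_of_mem hv
  have hw' : w ∈ fullSet V := by
    by_cases h : w ∈ V
    · exact mem_fullSet_of_mem h
    · exact Finset.mem_union_right _ (Finset.mem_sdiff.2 ⟨Finset.mem_biUnion.2 ⟨v, hv, hw⟩, h⟩)
  simpa only [pairProd, Sym2.lift_mk, spin_of_mem _ hv', spin_of_mem _ hw'] using
    pair_mem_positiveCone (⟨v, hv'⟩ : ↥(fullSet V)) ⟨w, hw'⟩

lemma sum_mem_positiveCone_of_site {V : Finset V2} {q : Quad → ℝ}
    (hq : ∀ i : ↥(fullSet V), (fun ω => q (ω i)) ∈ positiveCone ↥(fullSet V)) :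
    (fun ω => ∑ x : V, q (ω ⟨x, mem_fullSet_of_mem x.2⟩)) ∈ positiveCone ↥(fullSet V) :=
  sum_mem_positiveCone fun _ _ => hq _

lemma mag_spin (V : Finset V2) (g : ↥(fullSet V) → Bool) :
    mag V (spin V g) = ∑ x : V, spinVal (g ⟨x, mem_fullSet_of_mem x.2⟩) := by
  rw [mag, ← Finset.sum_coe_sort]
  exact Finset.sum_congr rfl fun x _ => spin_of_mem g _

/-- The **Griffiths–Hurst–Sherman inequality** for the total magnetization. -/
lemma tilted_third_cumulant_nonpos {β : ℝ} (hβ : 0 ≤ β) (V : Finset V2) {s : ℝ} (hs : 0 ≤ s) :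
    let Z := tiltedMoment (fun g => wPlus β V (spin V g)) (fun g => mag V (spin V g))
    Z 3 s * Z 0 s ^ 3 - 3 * Z 1 s * Z 2 s * Z 0 s ^ 2 + 2 * Z 1 s ^ 3 * Z 0 s ≤ 0 := by
  intro Z
  set m : (↥(fullSet V) → Bool) → ℝ := fun g => mag V (spin V g) with hm
  set w : (↥(fullSet V) → Bool) → ℝ := fun g => wPlus β V (spin V g) * Real.exp (s * m g) with hw
  have hsum := sum_four_replicas w m
  let H : (↥(fullSet V) → Quad) → ℝ := fun ω =>
    β * ∑ e ∈ edgesV V, (pairProd (spin V fun i => (ω i).1) e +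
      pairProd (spin V fun i => (ω i).2.1) e + pairProd (spin V fun i => (ω i).2.2.1) e +
      pairProd (spin V fun i => (ω i).2.2.2) e) +
    s * ∑ x : V, quadSum (ω ⟨x, mem_fullSet_of_mem x.2⟩)
  have hH : H ∈ positiveCone ↥(fullSet V) := add_mem
    (const_mul_mem_positiveCone hβ
      (sum_mem_positiveCone fun e he => replica_edge_mem_positiveCone he))
    (const_mul_mem_positiveCone hs (sum_mem_positiveCone_of_site quadSum_mem_positiveCone))
  have hnonneg := sum_prod_mul_exp_mul_nonneg (sum_quadWeight_mul_quadMonomial_nonneg V) hH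
    (mul_mem (mul_mem (sum_mem_positiveCone_of_site quadDiff₁_mem_positiveCone)
      (sum_mem_positiveCone_of_site quadDiff₂_mem_positiveCone))
      (sum_mem_positiveCone_of_site quadDiff₃_mem_positiveCone))
  have heq : ∑ a, ∑ b, ∑ c, ∑ d, w a * w b * w c * w d *
      ((m a + m b - m c - m d) * (m a - m b + m c - m d) * (-m a + m b + m c - m d)) =
      ∑ ω : ↥(fullSet V) → Quad, (∏ i, quadWeight V i (ω i)) * (Real.exp (H ω) *
        ((∑ x : V, quadDiff₁ (ω ⟨x, mem_fullSet_of_mem x.2⟩)) *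
          (∑ x : V, quadDiff₂ (ω ⟨x, mem_fullSet_of_mem x.2⟩)) *
          ∑ x : V, quadDiff₃ (ω ⟨x, mem_fullSet_of_mem x.2⟩))) := by
    refine Eq.trans ?_ (Fintype.sum_equiv (replicaEquiv _) _
      (fun p => w p.1 * w p.2.1 * w p.2.2.1 * w p.2.2.2 *
        ((m p.1 + m p.2.1 - m p.2.2.1 - m p.2.2.2) * (m p.1 - m p.2.1 + m p.2.2.1 - m p.2.2.2) *
          (-m p.1 + m p.2.1 + m p.2.2.1 - m p.2.2.2))) fun ω => ?_).symm
    · simp only [Fintype.sum_prod_type]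
    · simp only [replicaEquiv, Equiv.coe_fn_mk, prod_quadWeight, H, hw, hm, wPlus, mag_spin,
        quadSum, quadDiff₁, quadDiff₂, quadDiff₃, Finset.sum_add_distrib, Finset.sum_sub_distrib,
        Finset.sum_neg_distrib, mul_add, Real.exp_add]
      ring
  have hpoly : 0 ≤ ∑ a, ∑ b, ∑ c, ∑ d, w a * w b * w c * w d *
      ((m a + m b - m c - m d) * (m a - m b + m c - m d) * (-m a + m b + m c - m d)) :=
    heq ▸ hnonneg
  rw [hsum] at hpoly
  have h0 : Z 0 s = ∑ g, w g := by simp [Z, tiltedMoment, hw, hm]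
  have h1 : Z 1 s = ∑ g, w g * m g := by simp [Z, tiltedMoment, hw, hm]
  rw [h0, h1]
  change (∑ g, w g * m g ^ 3) * _ - 3 * _ * (∑ g, w g * m g ^ 2) * _ + _ ≤ 0
  linarith

lemma wPlus_nonneg (β : ℝ) (V : Finset V2) (σ : V2 → ℝ) : 0 ≤ wPlus β V σ := by
  unfold wPlus
  split_ifs <;> positivity

lemma sum_wPlus_pos (β : ℝ) (V : Finset V2) :
    0 < ∑ g : ↥(fullSet V) → Bool, wPlus β V (spin V g) := by
  refine Finset.sum_pos' (fun g _ => wPlus_nonneg β V _) ⟨fun _ => true, Finset.mem_univ _, ?_⟩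
  rw [wPlus, if_pos ((boundary_plus_iff V _).2 fun _ => Or.inr rfl)]
  positivity

lemma betaC_nonneg : 0 ≤ betaC :=
  div_nonneg (Real.log_nonneg (le_add_of_nonneg_left (Real.sqrt_nonneg 2))) zero_le_two

/-- For the critical Ising model with plus boundary conditions, for
every `t ≥ 0`:
`log E⁺[exp(tM)] ≤ t E⁺[M] + (t²/2) E⁺[(M − E⁺[M])²]`. -/
theorem log_mgf_magnetization_le
    (δ : ℝ) (hδ : 0 < δ) (V : Finset V2) (t : ℝ) (ht : 0 ≤ t) :
    Real.log (ePlus betaC V (fun σ => Real.exp (t * mag V σ))) ≤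
      t * ePlus betaC V (mag V) +
        t ^ 2 / 2 * ePlus betaC V (fun σ => (mag V σ - ePlus betaC V (mag V)) ^ 2) := by
  set w : (↥(fullSet V) → Bool) → ℝ := fun g => wPlus betaC V (spin V g) with hw
  set m : (↥(fullSet V) → Bool) → ℝ := fun g => mag V (spin V g) with hm
  have hpos : 0 < ∑ g, w g := sum_wPlus_pos betaC V
  have main := log_tiltedMoment_le (fun g => wPlus_nonneg betaC V (spin V g)) hpos
    (fun s hs => tilted_third_cumulant_nonpos betaC_nonneg V hs) ht
  have h0 : tiltedMoment w m 0 0 = ∑ g, w g := by simp [tiltedMoment]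
  have hmgf : ePlus betaC V (fun σ => Real.exp (t * mag V σ)) =
      tiltedMoment w m 0 t / tiltedMoment w m 0 0 := by
    rw [h0]
    simp [ePlus, tiltedMoment, hw, hm]
  have hmean : ePlus betaC V (mag V) = tiltedMoment w m 1 0 / tiltedMoment w m 0 0 := by
    rw [h0]
    simp [ePlus, tiltedMoment, hw, hm]
  have hvar : ∀ μ, μ = tiltedMoment w m 1 0 / tiltedMoment w m 0 0 →
      ePlus betaC V (fun σ => (mag V σ - μ) ^ 2) =
      tiltedMoment w m 2 0 / tiltedMoment w m 0 0 - μ ^ 2 := by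
    intro μ hμ
    have hsq : ∑ g, w g * (m g - μ) ^ 2 = tiltedMoment w m 2 0 - 2 * μ * tiltedMoment w m 1 0 +
        μ ^ 2 * tiltedMoment w m 0 0 := by
      simp only [tiltedMoment, Finset.mul_sum, ← Finset.sum_add_distrib, ← Finset.sum_sub_distrib]
      refine Finset.sum_congr rfl fun g _ => ?_
      simp only [zero_mul, Real.exp_zero]
      ring
    have hne : tiltedMoment w m 0 0 ≠ 0 := h0 ▸ hpos.ne'
    change (∑ g, w g * (m g - μ) ^ 2) / (∑ g, w g) = _
    rw [hsq, ← h0]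
    rw [hμ]
    field_simp
    ring
  have htpos : 0 < tiltedMoment w m 0 t := by
    obtain ⟨g, _, hg⟩ := Finset.exists_lt_of_sum_lt (f := fun _ => (0 : ℝ)) (by simpa using hpos)
    refine Finset.sum_pos' (fun g _ => ?_) ⟨g, Finset.mem_univ g, ?_⟩
    · have : 0 ≤ w g := wPlus_nonneg betaC V _
      positivity
    · positivity
  rw [hvar _ hmean, hmgf, Real.log_div htpos.ne' (h0 ▸ hpos.ne'), hmean]
  linarith

end
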